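/- Under the FPL algorithm with any parameter η > 0, the expected collected reward satisfies E[Σ_{t=1}^T V^{π_t}(r_t)] ≥ OPT − η H³ T − (H + H·ln(SA))/η. -/

import Mathlib

open MeasureTheory ProbabilityTheory

section MDP

variable {S A : Type} [Fintype S] [Fintype A]

/-- Validity of a transition kernel given as a function `S → A → S → ℝ`. -/
def IsKernel (p : S → A → S → ℝ) : Prop :=
  (∀ s a s', 0 ≤ p s a s') ∧ ∀ s a, ∑ s' : S, p s a s' = 1

/-- `polVal p r π n h s` is the expected reward collected by the deterministic policy `π`
in the MDP with transition kernel `p` and reward `r`, over `n` steps starting at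
state `s` in layer `h` (the layer increases by one at each step).  The value
`V^π_h(s, r)` of the paper is `polVal p r π (H + 1 - h) h s`, and
`V^π(r) = polVal p r π H 1 s₁`. -/
noncomputable def polVal (p : S → A → S → ℝ) (r : S → A → ℕ → ℝ) (π : S → ℕ → A) :
    ℕ → ℕ → S → ℝ
  | 0, _, _ => 0
  | n + 1, h, s =>
      r s (π s h) h + ∑ s' : S, p s (π s h) s' * polVal p r π n (h + 1) s'

/-- `optVal p r n h s` is the optimal value over `n` steps starting at state `s`
in layer `h`, computed by backward value iteration. -/
noncomputable def optVal [Nonempty A] (p : S → A → S → ℝ) (r : S → A → ℕ → ℝ) :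
    ℕ → ℕ → S → ℝ
  | 0, _, _ => 0
  | n + 1, h, s =>
      ⨆ a : A, (r s a h + ∑ s' : S, p s a s' * optVal p r n (h + 1) s')

/-- A policy is optimal for the reward `r` in the horizon-`H` MDP if it attains the optimal
value at every state and layer; this is exactly what backward value iteration produces. -/
def IsOptimal [Nonempty A] (p : S → A → S → ℝ) (r : S → A → ℕ → ℝ) (H : ℕ)
    (π : S → ℕ → A) : Prop :=
  ∀ h s, 1 ≤ h → h ≤ H → polVal p r π (H + 1 - h) h s = optVal p r (H + 1 - h) h s

end MDP


section Aux

variable {S A : Type} [Fintype S] [Fintype A]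

lemma aux_polVal_congr (p : S → A → S → ℝ) (r r' : S → A → ℕ → ℝ) (π : S → ℕ → A) (n : ℕ) :
    ∀ (h : ℕ) (s : S), (∀ s k, h ≤ k → k < h + n → r s (π s k) k = r' s (π s k) k) →
      polVal p r π n h s = polVal p r' π n h s := by
  induction n with
  | zero => intro h s _; rfl
  | succ n ih =>
    intro h s hr
    simp only [polVal]
    rw [hr s h le_rfl (by omega)]
    congr 1
    refine Finset.sum_congr rfl fun s' _ => ?_
    rw [ih (h + 1) s' fun s k h1 h2 => hr s k (by omega) (by omega)]

lemma aux_polVal_add (p : S → A → S → ℝ) (r r' : S → A → ℕ → ℝ) (π : S → ℕ → A) (n : ℕ) :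
    ∀ (h : ℕ) (s : S), polVal p (fun s a k => r s a k + r' s a k) π n h s
      = polVal p r π n h s + polVal p r' π n h s := by
  induction n with
  | zero => intro h s; simp [polVal]
  | succ n ih =>
    intro h s
    simp only [polVal, ih, mul_add, Finset.sum_add_distrib]
    ring

lemma aux_polVal_mul (p : S → A → S → ℝ) (c : ℝ) (r : S → A → ℕ → ℝ) (π : S → ℕ → A) (n : ℕ) :
    ∀ (h : ℕ) (s : S), polVal p (fun s a k => c * r s a k) π n h s
      = c * polVal p r π n h s := by
  induction n with
  | zero => intro h s; simp [polVal]
  | succ n ih =>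
    intro h s
    simp only [polVal, ih, mul_add, Finset.mul_sum]
    congr 1
    exact Finset.sum_congr rfl fun _ _ => by ring

lemma aux_polVal_zero (p : S → A → S → ℝ) (π : S → ℕ → A) (n h : ℕ) (s : S) :
    polVal p (fun _ _ _ => 0) π n h s = 0 := by
  have := aux_polVal_mul p 0 (fun _ _ _ => 0) π n h s
  simpa using this

lemma aux_polVal_sum {ι : Type} (p : S → A → S → ℝ) (r : ι → S → A → ℕ → ℝ) (π : S → ℕ → A)
    (n h : ℕ) (s : S) (t : Finset ι) :
    polVal p (fun s a k => ∑ i ∈ t, r i s a k) π n h s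
      = ∑ i ∈ t, polVal p (r i) π n h s := by
  classical
  induction t using Finset.induction_on with
  | empty => simpa using aux_polVal_zero p π n h s
  | insert i t hi ih =>
    simp only [Finset.sum_insert hi]
    rw [aux_polVal_add, ih]

lemma aux_polVal_nonneg (p : S → A → S → ℝ) (hp : IsKernel p) (r : S → A → ℕ → ℝ)
    (hr : ∀ s a k, 0 ≤ r s a k) (π : S → ℕ → A) (n : ℕ) :
    ∀ (h : ℕ) (s : S), 0 ≤ polVal p r π n h s := by
  induction n with
  | zero => intro h s; simp [polVal]
  | succ n ih =>
    intro h s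
    simp only [polVal]
    exact add_nonneg (hr _ _ _) (Finset.sum_nonneg fun s' _ => mul_nonneg (hp.1 _ _ _) (ih _ _))

lemma aux_polVal_const (p : S → A → S → ℝ) (hp : IsKernel p) (c : ℝ) (π : S → ℕ → A) (n : ℕ) :
    ∀ (h : ℕ) (s : S), polVal p (fun _ _ _ => c) π n h s = n * c := by
  induction n with
  | zero => intro h s; simp [polVal]
  | succ n ih =>
    intro h s
    simp only [polVal, ih, ← Finset.sum_mul, hp.2]
    push_cast; ring

lemma aux_polVal_mono (p : S → A → S → ℝ) (hp : IsKernel p) (r r' : S → A → ℕ → ℝ)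
    (hr : ∀ s a k, r s a k ≤ r' s a k) (π : S → ℕ → A) (n h : ℕ) (s : S) :
    polVal p r π n h s ≤ polVal p r' π n h s := by
  have h1 := aux_polVal_nonneg p hp (fun s a k => r' s a k + (-1) * r s a k)
    (fun s a k => by linarith [hr s a k]) π n h s
  rw [aux_polVal_add p r' (fun s a k => (-1) * r s a k), aux_polVal_mul] at h1
  linarith

variable [Nonempty A]

/-- state-action value of backward value iteration -/
noncomputable def auxQ (p : S → A → S → ℝ) (r : S → A → ℕ → ℝ) (n h : ℕ) (s : S) (a : A) : ℝ :=
  r s a h + ∑ s' : S, p s a s' * optVal p r n (h + 1) s'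

lemma aux_optVal_succ (p : S → A → S → ℝ) (r : S → A → ℕ → ℝ) (n h : ℕ) (s : S) :
    optVal p r (n + 1) h s = ⨆ a : A, auxQ p r n h s a := rfl

lemma auxQ_le (p : S → A → S → ℝ) (r : S → A → ℕ → ℝ) (n h : ℕ) (s : S) (a : A) :
    auxQ p r n h s a ≤ optVal p r (n + 1) h s := by
  rw [aux_optVal_succ]
  exact le_ciSup (Set.finite_range _).bddAbove a

lemma auxQ_exists (p : S → A → S → ℝ) (r : S → A → ℕ → ℝ) (n h : ℕ) (s : S) :
    ∃ a, auxQ p r n h s a = optVal p r (n + 1) h s := by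
  rw [aux_optVal_succ]
  exact exists_eq_ciSup_of_finite

lemma aux_optVal_le (p : S → A → S → ℝ) (r : S → A → ℕ → ℝ) (n h : ℕ) (s : S) (M : ℝ)
    (hM : ∀ a, auxQ p r n h s a ≤ M) : optVal p r (n + 1) h s ≤ M := by
  rw [aux_optVal_succ]
  exact ciSup_le hM

lemma aux_optVal_congr (p : S → A → S → ℝ) (r r' : S → A → ℕ → ℝ) (n : ℕ) :
    ∀ (h : ℕ) (s : S), (∀ s a k, h ≤ k → k < h + n → r s a k = r' s a k) →
      optVal p r n h s = optVal p r' n h s := by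
  induction n with
  | zero => intro h s _; rfl
  | succ n ih =>
    intro h s hr
    simp only [optVal]
    congr 1
    funext a
    rw [hr s a h le_rfl (by omega)]
    congr 1
    refine Finset.sum_congr rfl fun s' _ => ?_
    rw [ih (h + 1) s' fun s a k h1 h2 => hr s a k (by omega) (by omega)]

lemma aux_optVal_le_add (p : S → A → S → ℝ) (hp : IsKernel p) (r r' : S → A → ℕ → ℝ)
    (b : ℕ → ℝ) (hr : ∀ s a k, r' s a k ≤ r s a k + b k) (n : ℕ) :
    ∀ (h : ℕ) (s : S), optVal p r' n h s
      ≤ optVal p r n h s + ∑ j ∈ Finset.range n, b (h + j) := by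
  induction n with
  | zero => intro h s; simp [optVal]
  | succ n ih =>
    intro h s
    refine aux_optVal_le _ _ _ _ _ _ fun a => ?_
    have h1 := auxQ_le p r n h s a
    have h2 : ∑ s' : S, p s a s' * optVal p r' n (h + 1) s'
        ≤ ∑ s' : S, p s a s' * optVal p r n (h + 1) s'
          + ∑ j ∈ Finset.range n, b (h + 1 + j) := by
      calc ∑ s' : S, p s a s' * optVal p r' n (h + 1) s'
          ≤ ∑ s' : S, p s a s' * (optVal p r n (h + 1) s'
              + ∑ j ∈ Finset.range n, b (h + 1 + j)) :=
            Finset.sum_le_sum fun s' _ => mul_le_mul_of_nonneg_left (ih _ _) (hp.1 _ _ _)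
        _ = _ := by
            simp only [mul_add, Finset.sum_add_distrib, ← Finset.sum_mul, hp.2, one_mul]
    rw [Finset.sum_range_succ']
    have h3 : ∑ j ∈ Finset.range n, b (h + (j + 1)) = ∑ j ∈ Finset.range n, b (h + 1 + j) :=
      Finset.sum_congr rfl fun j _ => by congr 1; ring
    rw [h3]
    have h4 := hr s a h
    simp only [auxQ, add_zero] at *
    linarith

lemma aux_optVal_mono (p : S → A → S → ℝ) (hp : IsKernel p) (r r' : S → A → ℕ → ℝ)
    (hr : ∀ s a k, r' s a k ≤ r s a k) (n h : ℕ) (s : S) :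
    optVal p r' n h s ≤ optVal p r n h s := by
  simpa using aux_optVal_le_add p hp r r' (fun _ => 0) (by simpa using hr) n h s

lemma aux_optVal_zero (p : S → A → S → ℝ) (n : ℕ) : ∀ (h : ℕ) (s : S),
    optVal p (fun _ _ _ => 0) n h s = 0 := by
  induction n with
  | zero => intro h s; rfl
  | succ n ih =>
    intro h s
    simp [optVal, ih]

lemma aux_polVal_le_optVal (p : S → A → S → ℝ) (hp : IsKernel p) (r : S → A → ℕ → ℝ)
    (π : S → ℕ → A) (n : ℕ) : ∀ (h : ℕ) (s : S),
      polVal p r π n h s ≤ optVal p r n h s := by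
  induction n with
  | zero => intro h s; rfl
  | succ n ih =>
    intro h s
    refine le_trans ?_ (auxQ_le p r n h s (π s h))
    simp only [polVal, auxQ]
    gcongr with s' _
    · exact hp.1 _ _ _
    · exact ih _ _

/-- advantage gap -/
noncomputable def auxGap (p : S → A → S → ℝ) (H : ℕ) (r : S → A → ℕ → ℝ) (s : S) (a : A)
    (k : ℕ) : ℝ :=
  optVal p r (H - k + 1) k s - auxQ p r (H - k) k s a

lemma auxGap_nonneg (p : S → A → S → ℝ) (H : ℕ) (r : S → A → ℕ → ℝ) (s : S) (a : A)
    (k : ℕ) : 0 ≤ auxGap p H r s a k := sub_nonneg.2 (auxQ_le _ _ _ _ _ _)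

lemma aux_polVal_gap (p : S → A → S → ℝ) (H : ℕ) (r : S → A → ℕ → ℝ) (π : S → ℕ → A) (n : ℕ) :
    ∀ (h : ℕ) (s : S), n + h = H + 1 → 
      polVal p (auxGap p H r) π n h s = optVal p r n h s - polVal p r π n h s := by
  induction n with
  | zero => intro h s _; simp [polVal, optVal]
  | succ n ih =>
    intro h s hn
    have e : H - h = n := by omega
    simp only [polVal]
    rw [Finset.sum_congr rfl fun s' _ => by rw [ih (h + 1) s' (by omega)]]
    simp only [auxGap, e, auxQ, mul_sub, Finset.sum_sub_distrib]
    ring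

/-- greedy policies are optimal -/
lemma aux_greedy (p : S → A → S → ℝ) (H : ℕ) (r : S → A → ℕ → ℝ) (π : S → ℕ → A)
    (hπ : ∀ s k, auxQ p r (H - k) k s (π s k) = optVal p r (H - k + 1) k s) (n : ℕ) :
    ∀ (h : ℕ) (s : S), n + h = H + 1 → polVal p r π n h s = optVal p r n h s := by
  intro h s hn
  have h1 := aux_polVal_gap p H r π n h s hn
  have h2 : polVal p (auxGap p H r) π n h s = polVal p (fun _ _ _ => 0) π n h s :=
    aux_polVal_congr _ _ _ _ _ _ _ fun s k _ _ => by simp [auxGap, hπ]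
  rw [aux_polVal_zero] at h2
  linarith

/-- extension of a finite vector to a reward function -/
noncomputable def auxExt {H : ℕ} (x : S × A × Fin H → ℝ) (s : S) (a : A) (k : ℕ) : ℝ :=
  if hk : 1 ≤ k ∧ k ≤ H then x (s, a, ⟨k - 1, by omega⟩) else 0

open Classical in
/-- indicator reward -/
noncomputable def auxInd {H : ℕ} (i : S × A × Fin H) (s : S) (a : A) (k : ℕ) : ℝ :=
  if s = i.1 ∧ a = i.2.1 ∧ k = i.2.2.val + 1 then 1 else 0

lemma auxInd_nonneg {H : ℕ} (i : S × A × Fin H) (s : S) (a : A) (k : ℕ) : 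
    0 ≤ auxInd i s a k := by
  unfold auxInd; split_ifs <;> norm_num

lemma auxInd_le {H : ℕ} (i : S × A × Fin H) (s : S) (a : A) (k : ℕ) : 
    auxInd i s a k ≤ 1 := by
  unfold auxInd; split_ifs <;> norm_num

lemma aux_decomp {H : ℕ} (r : S → A → ℕ → ℝ) (s : S) (a : A) (k : ℕ) (h1 : 1 ≤ k) (h2 : k ≤ H) :
    r s a k = ∑ i : S × A × Fin H, r i.1 i.2.1 (i.2.2.val + 1) * auxInd i s a k := by
  classical
  rw [Finset.sum_eq_single (s, a, (⟨k - 1, by omega⟩ : Fin H))]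
  · have : k - 1 + 1 = k := by omega
    simp [auxInd, this]
  · rintro ⟨s', a', j⟩ _ hne
    have : ¬ (s = s' ∧ a = a' ∧ k = j.val + 1) := by
      rintro ⟨rfl, rfl, rfl⟩
      exact hne (by simp)
    simp [auxInd, this]
  · simp

lemma aux_polVal_decomp (p : S → A → S → ℝ) {H : ℕ} (r : S → A → ℕ → ℝ) (π : S → ℕ → A) (s : S) :
    polVal p r π H 1 s = ∑ i : S × A × Fin H, r i.1 i.2.1 (i.2.2.val + 1)
      * polVal p (auxInd i) π H 1 s := by
  simp only [← aux_polVal_mul]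
  rw [← aux_polVal_sum p (fun (i : S × A × Fin H) s a k =>
    r i.1 i.2.1 (i.2.2.val + 1) * auxInd i s a k)]
  exact aux_polVal_congr _ _ _ _ _ _ _ fun s k h1 h2 => aux_decomp r s _ k h1 (by omega)

open Classical in
lemma auxExt_shift {H : ℕ} (x : S × A × Fin H → ℝ) (i : S × A × Fin H) (u : ℝ) (s : S) (a : A)
    (k : ℕ) : auxExt (fun j => x j + if j = i then u else 0) s a k
      = auxExt x s a k + u * auxInd i s a k := by
  obtain ⟨s', a', j⟩ := i
  unfold auxExt auxInd
  by_cases hk : 1 ≤ k ∧ k ≤ H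
  · simp only [hk, and_self, dite_true]
    have : ((s, a, (⟨k - 1, by omega⟩ : Fin H)) = (s', a', j)) ↔
        (s = s' ∧ a = a' ∧ k = j.val + 1) := by
      simp only [Prod.mk.injEq, Fin.ext_iff]
      have : k - 1 = j.val ↔ k = j.val + 1 := by omega
      rw [this]
    simp only [this]
    split_ifs <;> simp
  · have : ¬ (k = j.val + 1) := by
      have := j.isLt; omega
    simp [hk, this]

/-- any two optimal policies: monotonicity -/
lemma aux_mono_opt (p : S → A → S → ℝ) (hp : IsKernel p) (H : ℕ) (r d : S → A → ℕ → ℝ)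
    (u : ℝ) (hu : 0 < u) (π π' : S → ℕ → A) (s : S)
    (h1 : polVal p r π H 1 s = optVal p r H 1 s)
    (h2 : polVal p (fun s a k => r s a k + u * d s a k) π' H 1 s
      = optVal p (fun s a k => r s a k + u * d s a k) H 1 s) :
    polVal p d π H 1 s ≤ polVal p d π' H 1 s := by
  have h3 := aux_polVal_le_optVal p hp r π' H 1 s
  have h4 := aux_polVal_le_optVal p hp (fun s a k => r s a k + u * d s a k) π H 1 s
  rw [← h2, aux_polVal_add, aux_polVal_add, aux_polVal_mul, aux_polVal_mul] at h4
  rw [← h1] at h3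
  have : u * polVal p d π H 1 s ≤ u * polVal p d π' H 1 s := by linarith
  exact le_of_mul_le_mul_left this hu

/-- occupancy is zero if the policy does not play the action -/
lemma aux_ind_zero (p : S → A → S → ℝ) {H : ℕ} (i : S × A × Fin H) (π : S → ℕ → A) (s : S)
    (h : π i.1 (i.2.2.val + 1) ≠ i.2.1) : polVal p (auxInd i) π H 1 s = 0 := by
  rw [← aux_polVal_zero p π H 1 s]
  refine aux_polVal_congr _ _ _ _ _ _ _ fun s k _ _ => ?_
  unfold auxInd
  rw [if_neg]
  rintro ⟨rfl, h2, rfl⟩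
  exact h h2

/-- gap bound for greedy action -/
lemma aux_gap_le (p : S → A → S → ℝ) (hp : IsKernel p) (H : ℕ) (r d : S → A → ℕ → ℝ) (c : ℝ)
    (hc : 0 ≤ c) (hd : ∀ s a k, 0 ≤ d s a k ∧ d s a k ≤ c) (s : S) (a : A) (k : ℕ)
    (hk1 : 1 ≤ k) (hk2 : k ≤ H)
    (ha : auxQ p r (H - k) k s a = optVal p r (H - k + 1) k s) :
    auxGap p H (fun s a k => r s a k + d s a k) s a k ≤ c * H := by
  have h1 := aux_optVal_le_add p hp r (fun s a k => r s a k + d s a k) (fun _ => c)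
    (fun s a k => by linarith [(hd s a k).2]) (H - k + 1) k s
  have h2 : auxQ p r (H - k) k s a ≤ auxQ p (fun s a k => r s a k + d s a k) (H - k) k s a := by
    unfold auxQ
    refine add_le_add (by linarith [(hd s a k).1]) (Finset.sum_le_sum fun s' _ => ?_)
    exact mul_le_mul_of_nonneg_left (aux_optVal_mono p hp _ _
      (fun s a k => by linarith [(hd s a k).1]) _ _ _) (hp.1 _ _ _)
  have h3 : ((H - k + 1 : ℕ) : ℝ) * c ≤ c * H := by
    rw [mul_comm]
    exact mul_le_mul_of_nonneg_left (by exact_mod_cast (by omega : H - k + 1 ≤ H)) hc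
  simp only [Finset.sum_const, Finset.card_range, nsmul_eq_mul] at h1
  unfold auxGap
  linarith

/-- after raising the reward of an action by at least its gap, the gap vanishes -/
lemma aux_gap_shift (p : S → A → S → ℝ) {H : ℕ} (r : S → A → ℕ → ℝ) (i : S × A × Fin H)
    (u : ℝ) (hu : 0 ≤ u) (hg : auxGap p H r i.1 i.2.1 (i.2.2.val + 1) ≤ u) :
    auxGap p H (fun s a k => r s a k + u * auxInd i s a k) i.1 i.2.1 (i.2.2.val + 1) ≤ 0 := by
  obtain ⟨s, a, j⟩ := i
  simp only at *
  have key : ∀ s', optVal p (fun s₀ a₀ k => r s₀ a₀ k + u * auxInd (s, a, j) s₀ a₀ k)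
      (H - (j.val + 1)) (j.val + 1 + 1) s' = optVal p r (H - (j.val + 1)) (j.val + 1 + 1) s' := by
    intro s'
    refine aux_optVal_congr _ _ _ _ _ _ fun s₀ a₀ k h1 h2 => ?_
    have : ¬ k = j.val + 1 := by omega
    simp [auxInd, this]
  have hq : ∀ b, auxQ p (fun s₀ a₀ k => r s₀ a₀ k + u * auxInd (s, a, j) s₀ a₀ k)
      (H - (j.val + 1)) (j.val + 1) s b
      = auxQ p r (H - (j.val + 1)) (j.val + 1) s b + u * auxInd (s, a, j) s b (j.val + 1) := by
    intro b
    unfold auxQ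
    simp only [key]
    ring
  unfold auxGap at *
  rw [sub_nonpos]
  refine aux_optVal_le _ _ _ _ _ _ fun b => ?_
  have h1 := auxQ_le p r (H - (j.val + 1)) (j.val + 1) s b
  rw [hq, hq]
  have haa : auxInd (s, a, j) s a (j.val + 1) = 1 := by simp [auxInd]
  rw [haa]
  by_cases hb : b = a
  · subst hb; rw [haa]
  · have : auxInd (s, a, j) s b (j.val + 1) = 0 := by simp [auxInd, hb]
    rw [this]
    linarith

end Aux

section AuxExp

lemma aux_pdf_shift (η u : ℝ) (hu : 0 ≤ u) (y : ℝ) :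
    exponentialPDF η (y - u)
      = ENNReal.ofReal (Real.exp (η * u)) * (Set.Ici u).indicator (exponentialPDF η) y := by
  by_cases h : u ≤ y
  · rw [Set.indicator_of_mem (by exact h), exponentialPDF_of_nonneg (by linarith),
      exponentialPDF_of_nonneg (by linarith), ← ENNReal.ofReal_mul (by positivity)]
    congr 1
    rw [mul_left_comm, ← Real.exp_add]
    congr 2; ring
  · rw [Set.indicator_of_notMem (by exact h), exponentialPDF_of_neg (by linarith [not_le.1 h])]
    simp

lemma aux_measurable_pdf (η : ℝ) : Measurable (exponentialPDF η) :=
  (measurable_exponentialPDFReal η).ennreal_ofReal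

lemma aux_exp_shift (η u : ℝ) (hu : 0 ≤ u) :
    (expMeasure η).map (fun x => x + u)
      = ENNReal.ofReal (Real.exp (η * u)) • (expMeasure η).restrict (Set.Ici u) := by
  have hpdf := aux_measurable_pdf η
  have e : expMeasure η = volume.withDensity (exponentialPDF η) := rfl
  ext s hs
  have hm : Measurable (fun x : ℝ => x + u) := by fun_prop
  rw [Measure.map_apply hm hs, Measure.smul_apply, Measure.restrict_apply hs, e,
    withDensity_apply _ (hm hs), withDensity_apply _ (hs.inter measurableSet_Ici),
    ← lintegral_indicator (hm hs), ← lintegral_indicator (hs.inter measurableSet_Ici)]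
  have h1 := lintegral_add_right_eq_self (μ := (volume : Measure ℝ))
    (fun y => s.indicator (fun y => exponentialPDF η (y - u)) y) u
  have h2 : ∀ x : ℝ, s.indicator (fun y => exponentialPDF η (y - u)) (x + u)
      = ((fun x => x + u) ⁻¹' s).indicator (exponentialPDF η) x := by
    intro x
    by_cases hx : x + u ∈ s <;> simp [Set.indicator, hx]
  simp only [h2] at h1
  rw [h1, smul_eq_mul, ← lintegral_const_mul _ (hpdf.indicator (hs.inter measurableSet_Ici))]
  refine lintegral_congr fun y => ?_
  by_cases hy : y ∈ s
  · simp only [Set.indicator_of_mem hy, aux_pdf_shift η u hu]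
    by_cases hy2 : y ∈ Set.Ici u
    · rw [Set.indicator_of_mem hy2, Set.indicator_of_mem (show y ∈ s ∩ Set.Ici u from ⟨hy, hy2⟩)]
    · rw [Set.indicator_of_notMem hy2, Set.indicator_of_notMem (fun h => hy2 h.2)]
  · rw [Set.indicator_of_notMem hy, Set.indicator_of_notMem (fun h => hy h.1)]
    simp

lemma aux_exp_nonneg (η : ℝ) : ∀ᵐ x ∂(expMeasure η), 0 ≤ x := by
  have e : expMeasure η = volume.withDensity (exponentialPDF η) := rfl
  rw [e, ae_withDensity_iff (aux_measurable_pdf η)]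
  refine Filter.Eventually.of_forall fun x hx => ?_
  by_contra h
  exact hx (exponentialPDF_of_neg (not_le.1 h))

lemma aux_exp_mean (η : ℝ) (hη : 0 < η) : ∫ x, x ∂(expMeasure η) = 1 / η := by
  have e : expMeasure η = volume.withDensity (exponentialPDF η) := rfl
  rw [e, integral_withDensity_eq_integral_toReal_smul (aux_measurable_pdf η)
    (Filter.Eventually.of_forall fun x => ENNReal.ofReal_lt_top)]
  have h1 : ∀ x : ℝ, (exponentialPDF η x).toReal • x
      = (Set.Ioi (0 : ℝ)).indicator (fun t => η * (t ^ ((2 : ℝ) - 1) * Real.exp (-(η * t)))) x := by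
    intro x
    by_cases hx : 0 < x
    · rw [Set.indicator_of_mem (by exact hx), exponentialPDF_of_nonneg hx.le,
        ENNReal.toReal_ofReal (by positivity), smul_eq_mul]
      norm_num
      ring
    · rw [Set.indicator_of_notMem (by exact hx)]
      rcases (not_lt.1 hx).lt_or_eq with h | h
      · simp [exponentialPDF_of_neg h]
      · simp [h]
  simp only [h1]
  rw [integral_indicator measurableSet_Ioi, integral_const_mul,
    Real.integral_rpow_mul_exp_neg_mul_Ioi (by norm_num) hη, Real.Gamma_two]
  norm_num
  field_simp

lemma aux_exp_integrable (η : ℝ) (hη : 0 < η) : Integrable (fun x : ℝ => x) (expMeasure η) := by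
  by_contra h
  have := integral_undef h
  rw [aux_exp_mean η hη] at this
  have : 0 < 1 / η := by positivity
  linarith

lemma aux_exp_excess (η : ℝ) (hη : 0 < η) (L : ℝ) (hL : 0 ≤ L) :
    ∫ x, max (x - L) 0 ∂(expMeasure η) = Real.exp (-(η * L)) / η := by
  have h1 : ∫ x, max (x - L) 0 ∂((expMeasure η).map (fun x => x + L)) = 1 / η := by
    rw [integral_map (by fun_prop) (by fun_prop), ← aux_exp_mean η hη]
    refine integral_congr_ae ?_
    filter_upwards [aux_exp_nonneg η] with x hx
    simp [hx]
  rw [aux_exp_shift η L hL, integral_smul_measure, ENNReal.toReal_ofReal (by positivity),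
    setIntegral_eq_integral_of_forall_compl_eq_zero, smul_eq_mul] at h1
  · rw [Real.exp_neg]
    field_simp at h1 ⊢
    linarith
  · intro x hx
    have : x < L := by simpa using hx
    exact max_eq_right (by linarith)

variable {ι : Type} [Fintype ι]

open Classical in
lemma aux_pi_shift (η : ℝ) (hη : 0 < η) (i : ι) (u : ℝ) (hu : 0 ≤ u) :
    (Measure.pi (fun _ : ι => expMeasure η)).map (fun x j => x j + if j = i then u else 0)
      ≤ ENNReal.ofReal (Real.exp (η * u)) • Measure.pi (fun _ : ι => expMeasure η) := by
  have := isProbabilityMeasure_expMeasure hη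
  have key : (Measure.pi (fun _ : ι => expMeasure η)).map
        (fun x j => x j + if j = i then u else 0)
      = ENNReal.ofReal (Real.exp (η * u)) • (Measure.pi (fun _ : ι => expMeasure η)).restrict
        (Set.univ.pi fun j => if j = i then Set.Ici u else Set.univ) := by
    have : ∀ j : ι, IsProbabilityMeasure ((expMeasure η).map
        (fun x : ℝ => x + if j = i then u else 0)) :=
      fun j => Measure.isProbabilityMeasure_map (by fun_prop)
    have h0 := Measure.pi_map_pi (μ := fun _ : ι => expMeasure η)
      (f := fun j (x : ℝ) => x + if j = i then u else 0) (fun j => by fun_prop)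
    refine h0.trans ?_
    refine Measure.pi_eq fun s hs => ?_
    rw [Measure.smul_apply, Measure.restrict_apply (MeasurableSet.univ_pi hs),
      ← Set.pi_inter_distrib, Measure.pi_pi, smul_eq_mul,
      ← Finset.mul_prod_erase _ _ (Finset.mem_univ i), ← Finset.mul_prod_erase _
        (fun j => (expMeasure η).map (fun x : ℝ => x + if j = i then u else 0) (s j))
        (Finset.mem_univ i), ← mul_assoc]
    congr 1
    · simp only [if_true]
      rw [aux_exp_shift η u hu, Measure.smul_apply, Measure.restrict_apply (hs i), smul_eq_mul]
    · refine Finset.prod_congr rfl fun j hj => ?_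
      simp [Finset.ne_of_mem_erase hj]
  rw [key]
  intro s
  simp only [Measure.smul_apply, smul_eq_mul]
  gcongr
  exact Measure.restrict_le_self

open Classical in
lemma aux_shift_integral (η : ℝ) (hη : 0 < η) (i : ι) (u : ℝ) (hu : 0 ≤ u) (F : (ι → ℝ) → ℝ)
    (hF : Measurable F) (hF0 : ∀ x, 0 ≤ F x)
    (hFi : Integrable F (Measure.pi (fun _ : ι => expMeasure η))) :
    Integrable (fun x => F (fun j => x j + if j = i then u else 0))
      (Measure.pi (fun _ : ι => expMeasure η)) ∧
    ∫ x, F (fun j => x j + if j = i then u else 0) ∂(Measure.pi (fun _ : ι => expMeasure η))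
      ≤ Real.exp (η * u) * ∫ x, F x ∂(Measure.pi (fun _ : ι => expMeasure η)) := by
  have hm : Measurable (fun (x : ι → ℝ) (j : ι) => x j + if j = i then u else 0) := by fun_prop
  have hI : Integrable F (ENNReal.ofReal (Real.exp (η * u)) •
      Measure.pi (fun _ : ι => expMeasure η)) := hFi.smul_measure ENNReal.ofReal_ne_top
  have hle := aux_pi_shift η hη i u hu
  constructor
  · exact (hI.mono_measure hle).comp_measurable hm
  · have := integral_mono_measure hle (Filter.Eventually.of_forall hF0) hI
    rw [integral_smul_measure, ENNReal.toReal_ofReal (by positivity), smul_eq_mul,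
      integral_map hm.aemeasurable hF.aestronglyMeasurable] at this
    exact this

lemma aux_pi_eval (η : ℝ) (hη : 0 < η) (i : ι) :
    MeasurePreserving (fun x : ι → ℝ => x i) (Measure.pi (fun _ : ι => expMeasure η))
      (expMeasure η) := by
  have := isProbabilityMeasure_expMeasure hη
  exact measurePreserving_eval (fun _ : ι => expMeasure η) i

end AuxExp

section AuxKey

lemma aux_select {X A : Type} [MeasurableSpace X] [Fintype A] [Nonempty A] (Q : X → A → Prop)
    (hQ : ∀ x, ∃ a, Q x a) (hm : ∀ a, MeasurableSet {x | Q x a}) :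
    ∃ f : X → A, (∀ x, Q x (f x)) ∧ ∀ a, MeasurableSet {x | f x = a} := by
  classical
  obtain ⟨e, he⟩ := exists_surjective_nat A
  have hex : ∀ x, ∃ N, Q x (e N) := fun x => by
    obtain ⟨a, ha⟩ := hQ x
    obtain ⟨N, rfl⟩ := he a
    exact ⟨N, ha⟩
  have hf : Measurable fun x => Nat.find (hex x) := measurable_find hex fun k => hm (e k)
  refine ⟨fun x => e (Nat.find (hex x)), fun x => Nat.find_spec (hex x), fun a => ?_⟩
  exact hf (MeasurableSet.of_discrete (s := {N | e N = a}))

variable {S A : Type} [Fintype S] [Fintype A] [Nonempty A]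

lemma aux_measurable_optVal {X : Type} [MeasurableSpace X] (p : S → A → S → ℝ)
    (R : X → S → A → ℕ → ℝ) (hR : ∀ s a k, Measurable fun x => R x s a k) (n : ℕ) :
    ∀ (h : ℕ) (s : S), Measurable fun x => optVal p (R x) n h s := by
  induction n with
  | zero => intro h s; simp only [optVal]; exact measurable_const
  | succ n ih =>
    intro h s
    simp only [optVal]
    refine Measurable.iSup fun a => (hR s a h).add ?_
    exact Finset.measurable_fun_sum _ fun s' _ => (ih (h + 1) s').const_mul _

lemma aux_measurable_Q {X : Type} [MeasurableSpace X] (p : S → A → S → ℝ)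
    (R : X → S → A → ℕ → ℝ) (hR : ∀ s a k, Measurable fun x => R x s a k) (n h : ℕ) (s : S)
    (a : A) : Measurable fun x => auxQ p (R x) n h s a := by
  refine (hR s a h).add ?_
  exact Finset.measurable_fun_sum _ fun s' _ =>
    (aux_measurable_optVal p R hR n (h + 1) s').const_mul _

lemma aux_measurable_gap {X : Type} [MeasurableSpace X] (p : S → A → S → ℝ) (H : ℕ)
    (R : X → S → A → ℕ → ℝ) (hR : ∀ s a k, Measurable fun x => R x s a k) (s : S)
    (a : A) (k : ℕ) : Measurable fun x => auxGap p H (R x) s a k :=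
  (aux_measurable_optVal p R hR _ _ _).sub (aux_measurable_Q p R hR _ _ _ _)

lemma aux_measurable_polVal {X : Type} [MeasurableSpace X] (p : S → A → S → ℝ)
    (r : S → A → ℕ → ℝ) (π : X → S → ℕ → A) (hπ : ∀ s k a, MeasurableSet {x | π x s k = a})
    (n : ℕ) : ∀ (h : ℕ) (s : S), Measurable fun x => polVal p r (π x) n h s := by
  classical
  induction n with
  | zero => intro h s; simp only [polVal]; exact measurable_const
  | succ n ih =>
    intro h s
    have : (fun x => polVal p r (π x) (n + 1) h s) = fun x => ∑ a : A,
        {x | π x s h = a}.indicator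
          (fun x => r s a h + ∑ s' : S, p s a s' * polVal p r (π x) n (h + 1) s') x := by
      funext x
      rw [Finset.sum_eq_single (π x s h)]
      · simp [polVal]
      · intro b _ hb
        exact Set.indicator_of_notMem (fun h => hb h.symm) _
      · simp
    rw [this]
    refine Finset.measurable_fun_sum _ fun a _ => Measurable.indicator ?_ (hπ s h a)
    refine measurable_const.add ?_
    exact Finset.measurable_fun_sum _ fun s' _ => (ih (h + 1) s').const_mul _

lemma aux_measurable_ext {H : ℕ} (s : S) (a : A) (k : ℕ) :
    Measurable fun x : S × A × Fin H → ℝ => auxExt x s a k := by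
  unfold auxExt
  split_ifs
  · exact measurable_pi_apply _
  · exact measurable_const

lemma aux_key (p : S → A → S → ℝ) (hp : IsKernel p) {H : ℕ} (hH : 0 < H) (s₁ : S) (η : ℝ)
    (hη : 0 < η) (B d : S → A → ℕ → ℝ) (c : ℝ) (hc : 0 < c)
    (hd : ∀ s a k, 0 ≤ d s a k ∧ d s a k ≤ c) :
    ∃ π : (S × A × Fin H → ℝ) → S → ℕ → A,
      (∀ x, polVal p (fun s a k => auxExt x s a k + B s a k) (π x) H 1 s₁
        = optVal p (fun s a k => auxExt x s a k + B s a k) H 1 s₁) ∧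
      (∀ s k a, MeasurableSet {x | π x s k = a}) ∧
      ∫ x, (optVal p (fun s a k => (auxExt x s a k + B s a k) + d s a k) H 1 s₁
          - polVal p (fun s a k => (auxExt x s a k + B s a k) + d s a k) (π x) H 1 s₁)
        ∂(Measure.pi (fun _ : S × A × Fin H => expMeasure η)) ≤ η * c ^ 2 * H ^ 3 := by
  classical
  have := isProbabilityMeasure_expMeasure hη
  set ν := Measure.pi (fun _ : S × A × Fin H => expMeasure η) with hν
  set R : (S × A × Fin H → ℝ) → S → A → ℕ → ℝ := fun x s a k => auxExt x s a k + B s a k with hRdef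
  have hR : ∀ s a k, Measurable fun x => R x s a k := fun s a k =>
    (aux_measurable_ext s a k).add_const _
  set R' : (S × A × Fin H → ℝ) → S → A → ℕ → ℝ := fun x s a k => R x s a k + d s a k with hR'def
  have hR' : ∀ s a k, Measurable fun x => R' x s a k := fun s a k => (hR s a k).add_const _
  have hsel : ∀ s k, ∃ f : (S × A × Fin H → ℝ) → A,
      (∀ x, auxQ p (R x) (H - k) k s (f x) = optVal p (R x) (H - k + 1) k s) ∧
      ∀ a, MeasurableSet {x | f x = a} := by
    intro s k
    refine aux_select (fun x a => auxQ p (R x) (H - k) k s a = optVal p (R x) (H - k + 1) k s)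
      (fun x => auxQ_exists _ _ _ _ _) fun a => ?_
    exact measurableSet_eq_fun (aux_measurable_Q p R hR _ _ _ _)
      (aux_measurable_optVal p R hR _ _ _)
  choose f hf1 hf2 using hsel
  set π : (S × A × Fin H → ℝ) → S → ℕ → A := fun x s k => f s k x with hπdef
  have hopt : ∀ x, polVal p (R x) (π x) H 1 s₁ = optVal p (R x) H 1 s₁ := fun x =>
    aux_greedy p H (R x) (π x) (fun s k => hf1 s k x) H 1 s₁ rfl
  refine ⟨π, hopt, hf2, ?_⟩
  set u : ℝ := c * H with hu
  have hHpos : (0 : ℝ) < H := by exact_mod_cast hH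
  have hu0 : 0 < u := by positivity
  set μ : (S × A × Fin H) → (S × A × Fin H → ℝ) → ℝ :=
    fun i x => polVal p (auxInd i) (π x) H 1 s₁ with hμ
  set G : (S × A × Fin H) → (S × A × Fin H → ℝ) → ℝ :=
    fun i x => auxGap p H (R' x) i.1 i.2.1 (i.2.2.val + 1) with hG
  have hμm : ∀ i, Measurable (μ i) := fun i => aux_measurable_polVal p _ π hf2 _ _ _
  have hGm : ∀ i, Measurable (G i) := fun i => aux_measurable_gap p H R' hR' _ _ _
  have hμ0 : ∀ i x, 0 ≤ μ i x := fun i x => aux_polVal_nonneg p hp _ (auxInd_nonneg i) _ _ _ _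
  have hμH : ∀ i x, μ i x ≤ H := fun i x => by
    have := aux_polVal_mono p hp _ (fun _ _ _ => 1) (auxInd_le i) (π x) H 1 s₁
    rw [aux_polVal_const p hp] at this
    simpa using this
  have hG0 : ∀ i x, 0 ≤ G i x := fun i x => auxGap_nonneg _ _ _ _ _ _
  have hGu : ∀ i x, μ i x ≠ 0 → G i x ≤ u := by
    intro i x hne
    have ha : π x i.1 (i.2.2.val + 1) = i.2.1 := by
      by_contra h
      exact hne (aux_ind_zero p i (π x) s₁ h)
    refine aux_gap_le p hp H (R x) d c hc.le hd _ _ _ (by omega) (by have := i.2.2.isLt; omega) ?_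
    rw [← ha]
    exact hf1 _ _ x
  have hμi : ∀ i, Integrable (μ i) ν := fun i =>
    Integrable.of_bound (hμm i).aestronglyMeasurable H (Filter.Eventually.of_forall fun x => by
      rw [Real.norm_eq_abs, abs_of_nonneg (hμ0 i x)]; exact hμH i x)
  have main : ∀ i, Integrable (fun x => G i x * μ i x) ν ∧
      ∫ x, G i x * μ i x ∂ν ≤ η * u ^ 2 * ∫ x, μ i x ∂ν := by
    intro i
    set F : (S × A × Fin H → ℝ) → ℝ := fun x => if G i x ≤ 0 then μ i x else 0 with hF
    have hFm : Measurable F := Measurable.ite ((hGm i) measurableSet_Iic) (hμm i) measurable_const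
    have hF0 : ∀ x, 0 ≤ F x := fun x => by
      simp only [hF]; split_ifs
      · exact hμ0 i x
      · exact le_rfl
    have hFle : ∀ x, F x ≤ μ i x := fun x => by
      simp only [hF]; split_ifs
      · exact le_rfl
      · exact hμ0 i x
    have hFi : Integrable F ν := (hμi i).mono' hFm.aestronglyMeasurable
      (Filter.Eventually.of_forall fun x => by
        rw [Real.norm_eq_abs, abs_of_nonneg (hF0 x)]; exact hFle x)
    obtain ⟨hs1, hs2⟩ := aux_shift_integral η hη i u hu0.le F hFm hF0 hFi
    have hsh : ∀ x, μ i x ≤ F (fun j => x j + if j = i then u else 0) := by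
      intro x
      by_cases hne : μ i x = 0
      · rw [hne]; exact hF0 _
      have hRs : R (fun j => x j + if j = i then u else 0)
          = fun s a k => R x s a k + u * auxInd i s a k := by
        funext s a k
        simp only [hRdef, auxExt_shift]
        ring
      have hRs' : R' (fun j => x j + if j = i then u else 0)
          = fun s a k => R' x s a k + u * auxInd i s a k := by
        funext s a k
        simp only [hR'def, hRs]
        ring
      have hg : G i (fun j => x j + if j = i then u else 0) ≤ 0 := by
        simp only [hG, hRs']
        exact aux_gap_shift p (R' x) i u hu0.le (hGu i x hne)
      simp only [hF, if_pos hg]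
      refine aux_mono_opt p hp H (R x) (auxInd i) u hu0 _ _ s₁ (hopt x) ?_
      rw [← hRs]
      exact hopt _
    have h1 : ∫ x, μ i x ∂ν ≤ Real.exp (η * u) * ∫ x, F x ∂ν :=
      (integral_mono (hμi i) hs1 fun x => (hsh x).trans (le_of_eq (by congr!))).trans hs2
    have hGF : ∀ x, G i x * μ i x ≤ u * (μ i x - F x) := by
      intro x
      by_cases hg : G i x ≤ 0
      · have : G i x = 0 := le_antisymm hg (hG0 i x)
        simp only [hF, if_pos hg, this]
        simp
      · simp only [hF, if_neg hg, sub_zero]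
        by_cases hne : μ i x = 0
        · simp [hne]
        · exact mul_le_mul_of_nonneg_right (hGu i x hne) (hμ0 i x)
    have hI2 : Integrable (fun x => u * (μ i x - F x)) ν := ((hμi i).sub hFi).const_mul u
    have hI : Integrable (fun x => G i x * μ i x) ν :=
      hI2.mono' ((hGm i).mul (hμm i)).aestronglyMeasurable
        (Filter.Eventually.of_forall fun x => by
          rw [Real.norm_eq_abs, abs_of_nonneg (mul_nonneg (hG0 i x) (hμ0 i x))]; exact hGF x)
    refine ⟨hI, ?_⟩
    have h2 := integral_mono hI hI2 hGF
    rw [integral_const_mul, integral_sub (hμi i) hFi] at h2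
    have h3 : 0 ≤ ∫ x, μ i x ∂ν := integral_nonneg (hμ0 i)
    have h4 : (1 - η * u) * ∫ x, μ i x ∂ν ≤ ∫ x, F x ∂ν := by
      have e1 : Real.exp (-(η * u)) * ∫ x, μ i x ∂ν ≤ ∫ x, F x ∂ν := by
        calc Real.exp (-(η * u)) * ∫ x, μ i x ∂ν
            ≤ Real.exp (-(η * u)) * (Real.exp (η * u) * ∫ x, F x ∂ν) :=
              mul_le_mul_of_nonneg_left h1 (Real.exp_pos _).le
          _ = ∫ x, F x ∂ν := by
              rw [← mul_assoc, ← Real.exp_add]; simp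
      refine le_trans (mul_le_mul_of_nonneg_right ?_ h3) e1
      linarith [Real.add_one_le_exp (-(η * u))]
    nlinarith [mul_le_mul_of_nonneg_left h4 hu0.le]
  have hsum : ∀ x, optVal p (R' x) H 1 s₁ - polVal p (R' x) (π x) H 1 s₁
      = ∑ i, G i x * μ i x := by
    intro x
    rw [← aux_polVal_gap p H (R' x) (π x) H 1 s₁ rfl, aux_polVal_decomp]
  have hone : ∀ x, ∑ i, μ i x = H := by
    intro x
    have h1 := aux_polVal_decomp p (H := H) (fun _ _ _ => 1) (π x) s₁
    rw [aux_polVal_const p hp] at h1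
    simp only [one_mul, mul_one] at h1
    exact h1.symm
  have hfin : ∑ i, ∫ x, μ i x ∂ν = H := by
    rw [← integral_finsetSum _ fun i _ => hμi i]
    simp [hone]
  calc ∫ x, (optVal p (R' x) H 1 s₁ - polVal p (R' x) (π x) H 1 s₁) ∂ν
      = ∑ i, ∫ x, G i x * μ i x ∂ν := by
        simp only [hsum]
        rw [integral_finsetSum _ fun i _ => (main i).1]
    _ ≤ ∑ i, η * u ^ 2 * ∫ x, μ i x ∂ν := Finset.sum_le_sum fun i _ => (main i).2
    _ = η * c ^ 2 * H ^ 3 := by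
        rw [← Finset.mul_sum, hfin, hu]; ring

end AuxKey

section AuxFinal

variable {S A : Type} [Fintype S] [Fintype A] [Nonempty A]

lemma aux_integrable_ext {H : ℕ} (η : ℝ) (hη : 0 < η) (s : S) (a : A) (k : ℕ) :
    Integrable (fun x : S × A × Fin H → ℝ => auxExt x s a k)
      (Measure.pi (fun _ : S × A × Fin H => expMeasure η)) := by
  have := isProbabilityMeasure_expMeasure hη
  unfold auxExt
  split_ifs
  · exact (aux_pi_eval η hη _).integrable_comp_of_integrable (aux_exp_integrable η hη)
  · exact integrable_const _

lemma aux_integrable_opt (p : S → A → S → ℝ) (hp : IsKernel p) {H : ℕ} (s₁ : S) (η : ℝ)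
    (hη : 0 < η) (B : S → A → ℕ → ℝ) :
    Integrable (fun x : S × A × Fin H → ℝ =>
      optVal p (fun s a k => auxExt x s a k + B s a k) H 1 s₁)
      (Measure.pi (fun _ : S × A × Fin H => expMeasure η)) := by
  have := isProbabilityMeasure_expMeasure hη
  set R : (S × A × Fin H → ℝ) → S → A → ℕ → ℝ := fun x s a k => auxExt x s a k + B s a k with hRdef
  have hR : ∀ s a k, Measurable fun x => R x s a k := fun s a k =>
    (aux_measurable_ext s a k).add_const _
  have hb : ∀ x s a k, |R x s a k| ≤ ∑ s, ∑ a, |R x s a k| := by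
    intro x s a k
    refine le_trans ?_ (Finset.single_le_sum (f := fun s => ∑ a, |R x s a k|)
      (fun s _ => Finset.sum_nonneg fun a _ => abs_nonneg _) (Finset.mem_univ s))
    exact Finset.single_le_sum (f := fun a => |R x s a k|)
      (fun a _ => abs_nonneg _) (Finset.mem_univ a)
  have hI : Integrable (fun x => ∑ j ∈ Finset.range H, ∑ s, ∑ a, |R x s a (1 + j)|)
      (Measure.pi (fun _ : S × A × Fin H => expMeasure η)) := by
    refine integrable_finsetSum _ fun j _ => integrable_finsetSum _ fun s _ =>
      integrable_finsetSum _ fun a _ => Integrable.abs ?_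
    exact (aux_integrable_ext η hη s a (1 + j)).add (integrable_const _)
  refine hI.mono' (aux_measurable_optVal p R hR H 1 s₁).aestronglyMeasurable
    (Filter.Eventually.of_forall fun x => ?_)
  rw [Real.norm_eq_abs, abs_le]
  have h1 := aux_optVal_le_add p hp (fun _ _ _ => 0) (R x) (fun k => ∑ s, ∑ a, |R x s a k|)
    (fun s a k => by linarith [hb x s a k, le_abs_self (R x s a k)]) H 1 s₁
  have h2 := aux_optVal_le_add p hp (R x) (fun _ _ _ => 0) (fun k => ∑ s, ∑ a, |R x s a k|)
    (fun s a k => by linarith [hb x s a k, neg_abs_le (R x s a k)]) H 1 s₁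
  rw [aux_optVal_zero] at h1 h2
  constructor <;> linarith

lemma aux_initial [Nonempty S] (p : S → A → S → ℝ) (hp : IsKernel p) {H : ℕ} (s₁ : S) (η : ℝ)
    (hη : 0 < η) :
    ∫ x : S × A × Fin H → ℝ, optVal p (fun s a k => auxExt x s a k + 0) H 1 s₁
      ∂(Measure.pi (fun _ : S × A × Fin H => expMeasure η))
    ≤ (H + H * Real.log (Fintype.card S * Fintype.card A)) / η := by
  have := isProbabilityMeasure_expMeasure hη
  set ν := Measure.pi (fun _ : S × A × Fin H => expMeasure η) with hν
  set N : ℝ := (Fintype.card S : ℝ) * Fintype.card A with hN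
  have hN1 : 1 ≤ N := by
    have h1 : (1 : ℝ) ≤ Fintype.card S := by exact_mod_cast Fintype.card_pos
    have h2 : (1 : ℝ) ≤ Fintype.card A := by exact_mod_cast Fintype.card_pos
    exact one_le_mul_of_one_le_of_one_le h1 h2
  set L : ℝ := Real.log N / η with hL
  have hL0 : 0 ≤ L := div_nonneg (Real.log_nonneg hN1) hη.le
  set b : (S × A × Fin H → ℝ) → ℕ → ℝ :=
    fun x k => L + ∑ s, ∑ a, max (auxExt x s a k - L) 0 with hb
  have hle : ∀ x, optVal p (fun s a k => auxExt x s a k + 0) H 1 s₁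
      ≤ ∑ j ∈ Finset.range H, b x (1 + j) := by
    intro x
    have h1 := aux_optVal_le_add p hp (fun _ _ _ => 0) (fun s a k => auxExt x s a k + 0) (b x)
      (fun s a k => ?_) H 1 s₁
    · rwa [aux_optVal_zero, zero_add] at h1
    · have h2 : max (auxExt x s a k - L) 0 ≤ ∑ s, ∑ a, max (auxExt x s a k - L) 0 := by
        refine le_trans ?_ (Finset.single_le_sum
          (f := fun s => ∑ a, max (auxExt x s a k - L) 0)
          (fun s _ => Finset.sum_nonneg fun a _ => le_max_right _ _) (Finset.mem_univ s))
        exact Finset.single_le_sum (f := fun a => max (auxExt x s a k - L) 0)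
          (fun a _ => le_max_right _ _) (Finset.mem_univ a)
      have h3 := le_max_left (auxExt x s a k - L) 0
      simp only [hb]
      linarith
  have hmi : ∀ s a k, Integrable (fun x : S × A × Fin H → ℝ => max (auxExt x s a k - L) 0) ν :=
    fun s a k => ((aux_integrable_ext η hη s a k).sub (integrable_const _)).pos_part
  have hsi : ∀ k, Integrable (fun x : S × A × Fin H → ℝ =>
      ∑ s, ∑ a, max (auxExt x s a k - L) 0) ν := fun k =>
    integrable_finsetSum _ fun s _ => integrable_finsetSum _ fun a _ => hmi s a k
  have hbi : ∀ k, Integrable (fun x => b x k) ν := fun k => (integrable_const _).add (hsi k)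
  have hval : ∀ j ∈ Finset.range H, ∫ x, b x (1 + j) ∂ν = L + 1 / η := by
    intro j hj
    have hj' := Finset.mem_range.1 hj
    simp only [hb]
    rw [integral_add (integrable_const _) (hsi _), integral_finsetSum _ fun s _ =>
      integrable_finsetSum _ fun a _ => hmi s a _]
    have : ∀ s : S, ∫ x : S × A × Fin H → ℝ, ∑ a, max (auxExt x s a (1 + j) - L) 0 ∂ν
        = ∑ a : A, Real.exp (-(η * L)) / η := by
      intro s
      rw [integral_finsetSum _ fun a _ => hmi s a _]
      refine Finset.sum_congr rfl fun a _ => ?_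
      have hmp := aux_pi_eval (ι := S × A × Fin H) η hη
        (s, a, ⟨1 + j - 1, by omega⟩)
      rw [← aux_exp_excess η hη L hL0, ← hmp.map_eq,
        integral_map hmp.measurable.aemeasurable (by fun_prop)]
      have hk : 1 ≤ 1 + j ∧ 1 + j ≤ H := by omega
      simp only [auxExt, hk, and_self, dite_true]
      rfl
    simp only [this]
    have hexp : Real.exp (-(η * L)) = 1 / N := by
      rw [hL, mul_div_cancel₀ _ hη.ne', Real.exp_neg, Real.exp_log (by linarith)]
      simp
    simp only [hexp, Finset.sum_const, Finset.card_univ, nsmul_eq_mul, integral_const]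
    simp only [probReal_univ, one_smul, add_right_inj]
    rw [← mul_assoc, ← hN]
    have : N ≠ 0 := by linarith
    field_simp
  calc _ ≤ ∫ x, ∑ j ∈ Finset.range H, b x (1 + j) ∂ν :=
        integral_mono (aux_integrable_opt p hp s₁ η hη (fun _ _ _ => 0))
          (integrable_finsetSum _ fun j _ => hbi _) hle
    _ = ∑ j ∈ Finset.range H, (L + 1 / η) := by
        rw [integral_finsetSum _ fun j _ => hbi _]
        exact Finset.sum_congr rfl hval
    _ = _ := by
        rw [Finset.sum_const, Finset.card_range, nsmul_eq_mul, hL]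
        field_simp
        ring

lemma aux_final [Nonempty S] (p : S → A → S → ℝ) (hp : IsKernel p) {H : ℕ} (s₁ : S) (η : ℝ)
    (hη : 0 < η) (r : S → A → ℕ → ℝ) (π : S → ℕ → A) :
    polVal p r π H 1 s₁ ≤
    ∫ x : S × A × Fin H → ℝ, optVal p (fun s a k => auxExt x s a k + r s a k) H 1 s₁
      ∂(Measure.pi (fun _ : S × A × Fin H => expMeasure η)) := by
  have := isProbabilityMeasure_expMeasure hη
  set ν := Measure.pi (fun _ : S × A × Fin H => expMeasure η) with hν
  have h0 : ∀ᵐ x ∂ν, ∀ i, 0 ≤ x i :=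
    ae_all_iff.2 fun i => (aux_pi_eval η hη i).quasiMeasurePreserving.ae (aux_exp_nonneg η)
  have h1 : ∫ _x : S × A × Fin H → ℝ, polVal p r π H 1 s₁ ∂ν = polVal p r π H 1 s₁ := by simp
  rw [← h1]
  refine integral_mono_ae (integrable_const _) (aux_integrable_opt p hp s₁ η hη r) ?_
  filter_upwards [h0] with x hx
  refine le_trans (aux_polVal_mono p hp _ _ (fun s a k => ?_) π H 1 s₁)
    (aux_polVal_le_optVal p hp _ π H 1 s₁)
  have : 0 ≤ auxExt x s a k := by
    unfold auxExt
    split_ifs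
    · exact hx _
    · exact le_rfl
  linarith

lemma aux_step {Ω : Type} [MeasurableSpace Ω] (P : Measure Ω) [IsProbabilityMeasure P]
    (p : S → A → S → ℝ) (hp : IsKernel p) {H : ℕ} (hH : 0 < H) (s₁ : S)
    (η : ℝ) (hη : 0 < η) (B r : S → A → ℕ → ℝ) (hr : ∀ s a k, 0 ≤ r s a k ∧ r s a k ≤ 1)
    (X : Ω → S × A × Fin H → ℝ) (hX : AEMeasurable X P)
    (hmap : P.map X = Measure.pi (fun _ : S × A × Fin H => expMeasure η))
    (π : Ω → S → ℕ → A)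
    (hopt : ∀ ω, polVal p (fun s a k => auxExt (X ω) s a k + B s a k) (π ω) H 1 s₁
      = optVal p (fun s a k => auxExt (X ω) s a k + B s a k) H 1 s₁)
    (hm : Measurable fun ω => polVal p r (π ω) H 1 s₁) :
    Integrable (fun ω => polVal p r (π ω) H 1 s₁) P ∧
    ∫ x, optVal p (fun s a k => auxExt x s a k + (B s a k + r s a k)) H 1 s₁
        ∂(Measure.pi (fun _ : S × A × Fin H => expMeasure η))
      - ∫ x, optVal p (fun s a k => auxExt x s a k + B s a k) H 1 s₁
        ∂(Measure.pi (fun _ : S × A × Fin H => expMeasure η)) - η * H ^ 3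
      ≤ ∫ ω, polVal p r (π ω) H 1 s₁ ∂P := by
  have := isProbabilityMeasure_expMeasure hη
  set ν := Measure.pi (fun _ : S × A × Fin H => expMeasure η) with hν
  have hpos : ∀ π : S → ℕ → A, 0 ≤ polVal p r π H 1 s₁ := fun π =>
    aux_polVal_nonneg p hp _ (fun s a k => (hr s a k).1) _ _ _ _
  have hle : ∀ π : S → ℕ → A, polVal p r π H 1 s₁ ≤ H := fun π => by
    have := aux_polVal_mono p hp r (fun _ _ _ => 1) (fun s a k => (hr s a k).2) π H 1 s₁
    rw [aux_polVal_const p hp] at this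
    simpa using this
  have hbd : ∀ π : S → ℕ → A, ‖polVal p r π H 1 s₁‖ ≤ H := fun π => by
    rw [Real.norm_eq_abs, abs_of_nonneg (hpos π)]; exact hle π
  have hint : Integrable (fun ω => polVal p r (π ω) H 1 s₁) P :=
    Integrable.of_bound hm.aestronglyMeasurable H (Filter.Eventually.of_forall fun ω => hbd _)
  refine ⟨hint, ?_⟩
  set E := ∫ ω, polVal p r (π ω) H 1 s₁ ∂P with hE
  set a₁ := ∫ x, optVal p (fun s a k => auxExt x s a k + (B s a k + r s a k)) H 1 s₁ ∂ν with ha₁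
  set a₀ := ∫ x, optVal p (fun s a k => auxExt x s a k + B s a k) H 1 s₁ ∂ν with ha₀
  have heps : ∀ ε : ℝ, 0 < ε → a₁ - a₀ - η * (1 + ε) ^ 2 * H ^ 3 ≤ (1 + ε) * E := by
    intro ε hε
    obtain ⟨q, hq1, hq2, hq3⟩ := aux_key p hp hH s₁ η hη (fun s a k => B s a k - ε * r s a k)
      (fun s a k => (1 + ε) * r s a k) (1 + ε) (by linarith) (fun s a k =>
        ⟨mul_nonneg (by linarith) (hr s a k).1, by nlinarith [(hr s a k).2]⟩)
    have hqm : Measurable fun x => polVal p r (q x) H 1 s₁ := aux_measurable_polVal p r q hq2 _ _ _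
    have hqi : Integrable (fun x => polVal p r (q x) H 1 s₁) ν :=
      Integrable.of_bound hqm.aestronglyMeasurable H (Filter.Eventually.of_forall fun ω => hbd _)
    have hqE : ∫ x, polVal p r (q x) H 1 s₁ ∂ν ≤ E := by
      rw [← hmap, integral_map hX hqm.aestronglyMeasurable]
      refine integral_mono ?_ hint fun ω => ?_
      · rw [← hmap] at hqi
        exact hqi.comp_aemeasurable hX
      · refine aux_mono_opt p hp H _ r ε hε _ _ s₁ (hq1 (X ω)) ?_
        have : (fun s a k => auxExt (X ω) s a k + (B s a k - ε * r s a k) + ε * r s a k)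
            = fun s a k => auxExt (X ω) s a k + B s a k := by
          funext s a k; ring
        rw [this]
        exact hopt ω
    have e1 : ∀ x : S × A × Fin H → ℝ,
        (fun s a k => auxExt x s a k + (B s a k - ε * r s a k) + (1 + ε) * r s a k)
          = fun s a k => auxExt x s a k + (B s a k + r s a k) := by
      intro x; funext s a k; ring
    have i1 := aux_integrable_opt (H := H) p hp s₁ η hη (fun s a k => B s a k + r s a k)
    have i0 := aux_integrable_opt (H := H) p hp s₁ η hη B
    have hlow : ∫ x, (optVal p (fun s a k => auxExt x s a k + (B s a k + r s a k)) H 1 s₁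
        - optVal p (fun s a k => auxExt x s a k + B s a k) H 1 s₁
        - (1 + ε) * polVal p r (q x) H 1 s₁) ∂ν ≤ η * (1 + ε) ^ 2 * H ^ 3 := by
      refine le_trans (integral_mono ((i1.sub i0).sub (hqi.const_mul _)) ?_ fun x => ?_) hq3
      · have e2 : ∀ x, polVal p (fun s a k => auxExt x s a k + (B s a k - ε * r s a k)
              + (1 + ε) * r s a k) (q x) H 1 s₁
            = optVal p (fun s a k => auxExt x s a k + (B s a k - ε * r s a k)) H 1 s₁
              + (1 + ε) * polVal p r (q x) H 1 s₁ := by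
          intro x
          rw [aux_polVal_add p (fun s a k => auxExt x s a k + (B s a k - ε * r s a k))
            (fun s a k => (1 + ε) * r s a k), hq1, aux_polVal_mul]
        simp only [e2]
        simp only [e1]
        exact i1.sub ((aux_integrable_opt (H := H) p hp s₁ η hη
          (fun s a k => B s a k - ε * r s a k)).add (hqi.const_mul _))
      · have h1 := aux_polVal_add p (fun s a k => auxExt x s a k + (B s a k - ε * r s a k))
          (fun s a k => (1 + ε) * r s a k) (q x) H 1 s₁
        rw [aux_polVal_mul, hq1 x] at h1
        have h2 := aux_optVal_mono p hp (fun s a k => auxExt x s a k + B s a k)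
          (fun s a k => auxExt x s a k + (B s a k - ε * r s a k))
          (fun s a k => by have := mul_nonneg hε.le (hr s a k).1; linarith) H 1 s₁
        simp only [Pi.sub_apply]
        rw [h1, e1 x]
        linarith
    have i2 : Integrable (fun x => optVal p (fun s a k => auxExt x s a k
        + (B s a k + r s a k)) H 1 s₁
        - optVal p (fun s a k => auxExt x s a k + B s a k) H 1 s₁) ν := i1.sub i0
    rw [integral_sub i2 (hqi.const_mul _), integral_sub i1 i0, integral_const_mul] at hlow
    have := mul_le_mul_of_nonneg_left hqE (by linarith : 0 ≤ 1 + ε)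
    linarith
  have hc1 : Filter.Tendsto (fun ε : ℝ => a₁ - a₀ - η * (1 + ε) ^ 2 * H ^ 3)
      (nhdsWithin 0 (Set.Ioi 0)) (nhds (a₁ - a₀ - η * (1 + 0) ^ 2 * H ^ 3)) := 
    (Continuous.tendsto (by fun_prop) 0).mono_left nhdsWithin_le_nhds
  have hc2 : Filter.Tendsto (fun ε : ℝ => (1 + ε) * E)
      (nhdsWithin 0 (Set.Ioi 0)) (nhds ((1 + 0) * E)) := 
    (Continuous.tendsto (by fun_prop) 0).mono_left nhdsWithin_le_nhds
  have := le_of_tendsto_of_tendsto hc1 hc2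
    (Filter.eventually_of_mem self_mem_nhdsWithin fun ε hε => heps ε hε)
  simpa using this

end AuxFinal

/-- Under the FPL algorithm with any parameter `η > 0`, the expected
collected reward satisfies
`E[Σ_{t=1}^T V^{π_t}(r_t)] ≥ OPT − η H³ T − (H + H ln(SA))/η`. -/
theorem fpl_reward_lower_bound
    {S A : Type} [Fintype S] [Fintype A] [Nonempty S] [Nonempty A]
    {Ω : Type} [MeasurableSpace Ω] (P : Measure Ω) [IsProbabilityMeasure P]
    (H T : ℕ) (hH : 0 < H) (hT : 0 < T) (s₁ : S)
    (p : S → A → S → ℝ) (hp : IsKernel p)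
    (η : ℝ) (hη : 0 < η)
    (r : ℕ → S → A → ℕ → ℝ) (hr : ∀ t s a h, 0 ≤ r t s a h ∧ r t s a h ≤ 1)
    (R0 : Ω → S → A → ℕ → ℝ)
    (hR0dist : ∀ s a h, 1 ≤ h → h ≤ H →
      Measure.map (fun ω => R0 ω s a h) P = expMeasure η)
    (hR0indep : iIndepFun
      (fun (x : S × A × Fin H) ω => R0 ω x.1 x.2.1 (x.2.2.val + 1)) P)
    (π : ℕ → Ω → S → ℕ → A)
    (hπopt : ∀ t ω, IsOptimal p
      (fun s a h => R0 ω s a h + ∑ τ ∈ Finset.Icc 1 (t - 1), r τ s a h) H (π t ω))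
    (hπmeas : ∀ t, Measurable fun ω => polVal p (r t) (π t ω) H 1 s₁) :
    ∀ πstar : S → ℕ → A,
      ∫ ω, ∑ t ∈ Finset.Icc 1 T, polVal p (r t) (π t ω) H 1 s₁ ∂P
        ≥ polVal p (fun s a h => ∑ τ ∈ Finset.Icc 1 T, r τ s a h) πstar H 1 s₁
            - η * H ^ 3 * T
            - (H + H * Real.log (Fintype.card S * Fintype.card A)) / η := by
  intro πstar
  have := isProbabilityMeasure_expMeasure hη
  set ν := Measure.pi (fun _ : S × A × Fin H => expMeasure η) with hν
  set X : Ω → S × A × Fin H → ℝ := fun ω x => R0 ω x.1 x.2.1 (x.2.2.val + 1) with hXdef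
  have hXi : ∀ i : S × A × Fin H, AEMeasurable (fun ω => X ω i) P := by
    intro i
    by_contra h
    have h1 := hR0dist i.1 i.2.1 (i.2.2.val + 1) (by omega) (by have := i.2.2.isLt; omega)
    rw [Measure.map_of_not_aemeasurable h] at h1
    exact IsProbabilityMeasure.ne_zero (expMeasure η) h1.symm
  have hX : AEMeasurable X P := aemeasurable_pi_iff.2 hXi
  have hmap : P.map X = ν := by
    have h1 := (iIndepFun_iff_map_fun_eq_pi_map hXi).1 hR0indep
    refine h1.trans ?_
    rw [hν]
    congr 1
    funext i
    exact hR0dist i.1 i.2.1 (i.2.2.val + 1) (by omega) (by have := i.2.2.isLt; omega)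
  have hext : ∀ ω s a k, 1 ≤ k → k ≤ H → auxExt (X ω) s a k = R0 ω s a k := by
    intro ω s a k h1 h2
    have : k - 1 + 1 = k := by omega
    simp [auxExt, h1, h2, hXdef, this]
  have hopt : ∀ t ω, polVal p (fun s a k => auxExt (X ω) s a k
        + ∑ τ ∈ Finset.Icc 1 (t - 1), r τ s a k) (π t ω) H 1 s₁
      = optVal p (fun s a k => auxExt (X ω) s a k
        + ∑ τ ∈ Finset.Icc 1 (t - 1), r τ s a k) H 1 s₁ := by
    intro t ω
    have h1 := hπopt t ω 1 s₁ le_rfl hH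
    rw [Nat.add_sub_cancel] at h1
    rw [aux_polVal_congr p _ (fun s a h => R0 ω s a h
        + ∑ τ ∈ Finset.Icc 1 (t - 1), r τ s a h) (π t ω) H 1 s₁
        (fun s k h1 h2 => by rw [hext ω s _ k h1 (by omega)]), h1]
    exact aux_optVal_congr _ _ _ _ _ _
      (fun s a k h1 h2 => by rw [hext ω s a k h1 (by omega)])
  set a : ℕ → ℝ := fun t => ∫ x, optVal p (fun s a k => auxExt x s a k
    + ∑ τ ∈ Finset.Icc 1 t, r τ s a k) H 1 s₁ ∂ν with ha
  have hstep := fun t => aux_step P p hp hH s₁ η hη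
    (fun s a k => ∑ τ ∈ Finset.Icc 1 (t - 1), r τ s a k) (r t) (hr t) X hX hmap (π t)
    (hopt t) (hπmeas t)
  have hE : ∀ t : ℕ, a (t + 1) - a t - η * H ^ 3
      ≤ ∫ ω, polVal p (r (t + 1)) (π (t + 1) ω) H 1 s₁ ∂P := by
    intro t
    have h1 := (hstep (t + 1)).2
    simp only [Nat.add_sub_cancel] at h1
    have e : ∀ s a k, ∑ τ ∈ Finset.Icc 1 t, r τ s a k + r (t + 1) s a k
        = ∑ τ ∈ Finset.Icc 1 (t + 1), r τ s a k := fun s a k =>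
      (Finset.sum_Icc_succ_top (by omega) _).symm
    simp only [e] at h1
    exact h1
  have hsum : ∀ n : ℕ, a n - a 0 - η * H ^ 3 * n
      ≤ ∑ t ∈ Finset.Icc 1 n, ∫ ω, polVal p (r t) (π t ω) H 1 s₁ ∂P := by
    intro n
    induction n with
    | zero => simp
    | succ n ih =>
      rw [Finset.sum_Icc_succ_top (by omega)]
      have := hE n
      push_cast
      linarith
  rw [integral_finsetSum _ fun t _ => (hstep t).1]
  have h0 : a 0 ≤ (H + H * Real.log (Fintype.card S * Fintype.card A)) / η := by
    have := aux_initial (H := H) p hp s₁ η hη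
    simpa [ha] using this
  have hT' := aux_final (H := H) p hp s₁ η hη
    (fun s a k => ∑ τ ∈ Finset.Icc 1 T, r τ s a k) πstar
  have := hsum T
  change _ ≤ a T at hT'
  linarith
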